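/- arXiv:2011.08437 — 11 statements merged into one kernel-verified Lean document; each statement's English description precedes it below -/
import Mathlib

section
/- Let N be a positive natural number and let A₁, A₂, B₁, B₂ ∈ Matrix (Fin N) (Fin N) ℂ be Hermitian matrices such that every Aᵢ commutes with every Bⱼ. Then the matrix (1/√2) · (A₁² + A₂² + B₁² + B₂²) − (A₁*B₁ + A₁*B₂ + A₂*B₁ − A₂*B₂) is positive semidefinite. -/
open Matrix ComplexOrder

/-- For Hermitian matrices `A₁, A₂, B₁, B₂` such that each `Aᵢ`
commutes with each `Bⱼ`, the matrix
`(1/√2) • (A₁² + A₂² + B₁² + B₂²) − (A₁B₁ + A₁B₂ + A₂B₁ − A₂B₂)`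
is positive semidefinite. -/
theorem tsirelson_operator_inequality (N : ℕ) (hN : 0 < N)
    (A₁ A₂ B₁ B₂ : Matrix (Fin N) (Fin N) ℂ)
    (hA₁ : A₁.IsHermitian) (hA₂ : A₂.IsHermitian)
    (hB₁ : B₁.IsHermitian) (hB₂ : B₂.IsHermitian)
    (h₁₁ : A₁ * B₁ = B₁ * A₁) (h₁₂ : A₁ * B₂ = B₂ * A₁)
    (h₂₁ : A₂ * B₁ = B₁ * A₂) (h₂₂ : A₂ * B₂ = B₂ * A₂) :
    ((Real.sqrt 2)⁻¹ • (A₁ ^ 2 + A₂ ^ 2 + B₁ ^ 2 + B₂ ^ 2) -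
        (A₁ * B₁ + A₁ * B₂ + A₂ * B₁ - A₂ * B₂)).PosSemidef := by
  have hc : (Real.sqrt 2)⁻¹ * (Real.sqrt 2)⁻¹ = 1 / 2 := by
    rw [← mul_inv, Real.mul_self_sqrt (by norm_num)]; norm_num
  have hc0 : 0 ≤ (Real.sqrt 2)⁻¹ := by positivity
  generalize (Real.sqrt 2)⁻¹ = c at hc hc0
  have hX : (A₁ - c • (B₁ + B₂))ᴴ = A₁ - c • (B₁ + B₂) := by
    simp [conjTranspose_sub, conjTranspose_smul, hA₁.eq, hB₁.eq, hB₂.eq]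
  have hY : (A₂ - c • (B₁ - B₂))ᴴ = A₂ - c • (B₁ - B₂) := by
    simp [conjTranspose_sub, conjTranspose_smul, hA₂.eq, hB₁.eq, hB₂.eq]
  have key : c • (A₁ ^ 2 + A₂ ^ 2 + B₁ ^ 2 + B₂ ^ 2) -
        (A₁ * B₁ + A₁ * B₂ + A₂ * B₁ - A₂ * B₂) =
      c • ((A₁ - c • (B₁ + B₂))ᴴ * (A₁ - c • (B₁ + B₂)) +
        (A₂ - c • (B₁ - B₂))ᴴ * (A₂ - c • (B₁ - B₂))) := by
    rw [hX, hY]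
    simp only [pow_two, sub_mul, mul_sub, add_mul, mul_add, smul_mul_assoc, mul_smul_comm,
      ← h₁₁, ← h₁₂, ← h₂₁, ← h₂₂, smul_add, smul_sub]
    match_scalars <;> first | ring1 | linear_combination (2 : ℝ) * hc | linear_combination (-2 : ℝ) * hc | linear_combination (2 * c) * hc | linear_combination (-2 * c) * hc
  rw [key]
  exact ((posSemidef_conjTranspose_mul_self _).add
    (posSemidef_conjTranspose_mul_self _)).smul hc0
end

section
/- Let N be a positive natural number and let A₁, A₂, B₁, B₂ ∈ Matrix (Fin N) (Fin N) ℂ be Hermitian matrices with A₁² = 1, A₂² = 1, B₁² = 1, B₂² = 1, such that every Aᵢ commutes with every Bⱼ. Then the matrix (2√2) • 1 − (A₁*B₁ + A₁*B₂ + A₂*B₁ − A₂*B₂) is positive semidefinite; that is, A₁B₁ + A₁B₂ + A₂B₁ − A₂B₂ ≤ 2√2 · 1 in the Loewner order. -/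
open Matrix ComplexOrder

/-- For Hermitian dichotomic matrices `A₁, A₂, B₁, B₂`
(squaring to the identity) such that each `Aᵢ` commutes with each `Bⱼ`,
`(2√2) • 1 − (A₁B₁ + A₁B₂ + A₂B₁ − A₂B₂)` is positive semidefinite, i.e.
the CHSH/Leggett–Garg operator is bounded by `2√2 · 1` in the Loewner order. -/
theorem tsirelson_bound_dichotomic (N : ℕ) (hN : 0 < N)
    (A₁ A₂ B₁ B₂ : Matrix (Fin N) (Fin N) ℂ)
    (hA₁ : A₁.IsHermitian) (hA₂ : A₂.IsHermitian)
    (hB₁ : B₁.IsHermitian) (hB₂ : B₂.IsHermitian)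
    (hA₁2 : A₁ ^ 2 = 1) (hA₂2 : A₂ ^ 2 = 1)
    (hB₁2 : B₁ ^ 2 = 1) (hB₂2 : B₂ ^ 2 = 1)
    (h₁₁ : A₁ * B₁ = B₁ * A₁) (h₁₂ : A₁ * B₂ = B₂ * A₁)
    (h₂₁ : A₂ * B₁ = B₁ * A₂) (h₂₂ : A₂ * B₂ = B₂ * A₂) :
    ((2 * Real.sqrt 2) • (1 : Matrix (Fin N) (Fin N) ℂ) -
        (A₁ * B₁ + A₁ * B₂ + A₂ * B₁ - A₂ * B₂)).PosSemidef := by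
  have hs : Real.sqrt 2 * Real.sqrt 2 = 2 := Real.mul_self_sqrt (by norm_num)
  have hs0 : 0 ≤ Real.sqrt 2 := Real.sqrt_nonneg 2
  generalize Real.sqrt 2 = s at hs hs0 ⊢
  rw [pow_two] at hA₁2 hA₂2 hB₁2 hB₂2
  have key : (2 * s) • (1 : Matrix (Fin N) (Fin N) ℂ) -
        (A₁ * B₁ + A₁ * B₂ + A₂ * B₁ - A₂ * B₂) =
      (s / 4) • ((B₁ + B₂ - s • A₁)ᴴ * (B₁ + B₂ - s • A₁) +
        (B₁ - B₂ - s • A₂)ᴴ * (B₁ - B₂ - s • A₂)) := by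
    have e1 : (B₁ + B₂ - s • A₁)ᴴ = B₁ + B₂ - s • A₁ := by
      simp [conjTranspose_sub, conjTranspose_add, conjTranspose_smul, hA₁.eq, hB₁.eq, hB₂.eq]
    have e2 : (B₁ - B₂ - s • A₂)ᴴ = B₁ - B₂ - s • A₂ := by
      simp [conjTranspose_sub, conjTranspose_smul, hA₂.eq, hB₁.eq, hB₂.eq]
    have e3 : (B₁ + B₂ - s • A₁) * (B₁ + B₂ - s • A₁) +
        (B₁ - B₂ - s • A₂) * (B₁ - B₂ - s • A₂) =
        (8 : ℝ) • (1 : Matrix (Fin N) (Fin N) ℂ) -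
        (2 * s) • (A₁ * B₁ + A₁ * B₂ + A₂ * B₁ - A₂ * B₂) := by
      simp only [mul_sub, sub_mul, mul_add, add_mul, smul_mul_assoc, mul_smul_comm, smul_smul,
        hA₁2, hA₂2, hB₁2, hB₂2, hs, ← h₁₁, ← h₁₂, ← h₂₁, ← h₂₂]
      match_scalars <;> linarith
    rw [e1, e2, e3, smul_sub, smul_smul, smul_smul]
    have e4 : s / 4 * (2 * s) = 1 := by linarith
    have e5 : s / 4 * 8 = 2 * s := by ring
    rw [e4, e5, one_smul]
  rw [key]
  exact ((posSemidef_conjTranspose_mul_self _).add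
    (posSemidef_conjTranspose_mul_self _)).smul (by positivity : 0 ≤ s / 4)
end

section
/- Let N be a positive natural number, let a₁, a₂, b₁, b₂ ∈ Matrix (Fin N) (Fin N) ℂ be Hermitian matrices with a₁² = 1, a₂² = 1, b₁² = 1, b₂² = 1, and define the temporal-setting observables Aᵢ = 1 ⊗ₖ aᵢ and Bⱼ = bⱼ ⊗ₖ 1 on the index type Fin N × Fin N (Kronecker products with the identity). Then for every density matrix W on Fin N × Fin N, the real part of Tr((A₁*B₁ + A₁*B₂ + A₂*B₁ − A₂*B₂) * W) is at most 2√2. -/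
open Matrix ComplexOrder Kronecker

theorem tsirelson_aux {n : Type*} [Fintype n] [DecidableEq n]
    (A₁ A₂ B₁ B₂ W : Matrix n n ℂ)
    (hA₁ : A₁ᴴ = A₁) (hA₂ : A₂ᴴ = A₂) (hB₁ : B₁ᴴ = B₁) (hB₂ : B₂ᴴ = B₂)
    (a1 : A₁ * A₁ = 1) (a2 : A₂ * A₂ = 1) (b1 : B₁ * B₁ = 1) (b2 : B₂ * B₂ = 1)
    (c11 : B₁ * A₁ = A₁ * B₁) (c12 : B₂ * A₁ = A₁ * B₂)
    (c21 : B₁ * A₂ = A₂ * B₁) (c22 : B₂ * A₂ = A₂ * B₂)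
    (hW : W.PosSemidef) (hWtr : W.trace = 1) :
    (((A₁ * B₁ + A₁ * B₂ + A₂ * B₁ - A₂ * B₂) * W).trace).re ≤ 2 * Real.sqrt 2 := by
  have hs0 : 0 < Real.sqrt 2 := by positivity
  have hs2 : Real.sqrt 2 * Real.sqrt 2 = 2 := Real.mul_self_sqrt (by norm_num)
  have hsc : ((Real.sqrt 2 : ℝ) : ℂ) * ((Real.sqrt 2 : ℝ) : ℂ) = 2 := by exact_mod_cast hs2
  generalize Real.sqrt 2 = s at *
  have key : ∀ P : Matrix n n ℂ, Pᴴ = P → 0 ≤ ((P * P * W).trace).re := by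
    intro P hP
    have h := (hW.mul_mul_conjTranspose_same P).trace_nonneg
    rw [hP, Matrix.trace_mul_comm, ← Matrix.mul_assoc] at h
    exact (Complex.le_def.1 h).1
  have h1 := key ((s : ℂ) • A₁ - (B₁ + B₂)) (by simp [hA₁, hB₁, hB₂])
  have h2 := key ((s : ℂ) • A₂ - (B₁ - B₂)) (by simp [hA₂, hB₁, hB₂])
  have e : ((s : ℂ) • A₁ - (B₁ + B₂)) * ((s : ℂ) • A₁ - (B₁ + B₂))
      + ((s : ℂ) • A₂ - (B₁ - B₂)) * ((s : ℂ) • A₂ - (B₁ - B₂))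
      = (8 : ℂ) • (1 : Matrix n n ℂ)
        - (2 * (s : ℂ)) • (A₁ * B₁ + A₁ * B₂ + A₂ * B₁ - A₂ * B₂) := by
    simp only [mul_add, add_mul, mul_sub, sub_mul, smul_mul_assoc, mul_smul_comm,
      a1, a2, b1, b2, c11, c12, c21, c22]
    match_scalars <;> first | ring1 | linear_combination 2 * hsc
  have h3 := add_nonneg h1 h2
  rw [← Complex.add_re, ← Matrix.trace_add, ← add_mul, e, sub_mul, Matrix.trace_sub,
    smul_mul_assoc, smul_mul_assoc, Matrix.trace_smul, Matrix.trace_smul, one_mul, hWtr] at h3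
  generalize ((A₁ * B₁ + A₁ * B₂ + A₂ * B₁ - A₂ * B₂) * W).trace = t at *
  simp at h3
  nlinarith

/-- **temporal Tsirelson bound, Lemma 2 of the paper.**
For Hermitian dichotomic observables `a₁, a₂, b₁, b₂` on a single `N`-level system,
define the temporal-setting observables `Aᵢ = 1 ⊗ₖ aᵢ` (measurement at time `t₁`)
and `Bⱼ = bⱼ ⊗ₖ 1` (measurement at time `t₂`).  Then for every history density
matrix `W`, the Leggett–Garg expression
`S_LGI = Re Tr((A₁B₁ + A₁B₂ + A₂B₁ − A₂B₂) W)` is at most `2√2`. -/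
theorem temporal_tsirelson_bound (N : ℕ) (hN : 0 < N)
    (a₁ a₂ b₁ b₂ : Matrix (Fin N) (Fin N) ℂ)
    (ha₁ : a₁.IsHermitian) (ha₂ : a₂.IsHermitian)
    (hb₁ : b₁.IsHermitian) (hb₂ : b₂.IsHermitian)
    (ha₁2 : a₁ ^ 2 = 1) (ha₂2 : a₂ ^ 2 = 1)
    (hb₁2 : b₁ ^ 2 = 1) (hb₂2 : b₂ ^ 2 = 1)
    (W : Matrix (Fin N × Fin N) (Fin N × Fin N) ℂ)
    (hW : W.PosSemidef) (hWtr : W.trace = 1) :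
    letI A₁ : Matrix (Fin N × Fin N) (Fin N × Fin N) ℂ := (1 : Matrix (Fin N) (Fin N) ℂ) ⊗ₖ a₁
    letI A₂ : Matrix (Fin N × Fin N) (Fin N × Fin N) ℂ := (1 : Matrix (Fin N) (Fin N) ℂ) ⊗ₖ a₂
    letI B₁ : Matrix (Fin N × Fin N) (Fin N × Fin N) ℂ := b₁ ⊗ₖ (1 : Matrix (Fin N) (Fin N) ℂ)
    letI B₂ : Matrix (Fin N × Fin N) (Fin N × Fin N) ℂ := b₂ ⊗ₖ (1 : Matrix (Fin N) (Fin N) ℂ)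
    (((A₁ * B₁ + A₁ * B₂ + A₂ * B₁ - A₂ * B₂) * W).trace).re ≤ 2 * Real.sqrt 2 := by
  rw [pow_two] at ha₁2 ha₂2 hb₁2 hb₂2
  apply tsirelson_aux _ _ _ _ W _ _ _ _ _ _ _ _ _ _ _ _ hW hWtr <;>
    simp [Matrix.conjTranspose_kronecker, ← Matrix.mul_kronecker_mul,
      ha₁.eq, ha₂.eq, hb₁.eq, hb₂.eq, ha₁2, ha₂2, hb₁2, hb₂2]
end

section
/- Let N be a positive natural number and let A₁, A₂, B₁, B₂ ∈ Matrix (Fin N) (Fin N) ℂ be Hermitian matrices with A₁² = 1, A₂² = 1, B₁² = 1, B₂² = 1 (no commutation assumed). Then the matrix (2√2) • 1 − (1/2) · ((A₁*B₁ + B₁*A₁) + (A₁*B₂ + B₂*A₁) + (A₂*B₁ + B₁*A₂) − (A₂*B₂ + B₂*A₂)) is positive semidefinite. -/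
open Matrix ComplexOrder

/-- For Hermitian dichotomic matrices `A₁, A₂, B₁, B₂`
(squaring to the identity, with no commutation assumed), the symmetrized
sequential-measurement CHSH operator is bounded by `2√2 · 1` in the Loewner
order:
`(2√2) • 1 − (1/2) • ((A₁B₁+B₁A₁) + (A₁B₂+B₂A₁) + (A₂B₁+B₁A₂) − (A₂B₂+B₂A₂))`
is positive semidefinite. -/
theorem sequential_tsirelson_operator_bound (N : ℕ) (hN : 0 < N)
    (A₁ A₂ B₁ B₂ : Matrix (Fin N) (Fin N) ℂ)
    (hA₁ : A₁.IsHermitian) (hA₂ : A₂.IsHermitian)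
    (hB₁ : B₁.IsHermitian) (hB₂ : B₂.IsHermitian)
    (hA₁2 : A₁ ^ 2 = 1) (hA₂2 : A₂ ^ 2 = 1)
    (hB₁2 : B₁ ^ 2 = 1) (hB₂2 : B₂ ^ 2 = 1) :
    ((2 * Real.sqrt 2) • (1 : Matrix (Fin N) (Fin N) ℂ) -
        (2 : ℝ)⁻¹ • ((A₁ * B₁ + B₁ * A₁) + (A₁ * B₂ + B₂ * A₁) +
          (A₂ * B₁ + B₁ * A₂) - (A₂ * B₂ + B₂ * A₂))).PosSemidef := by
  have hs : Real.sqrt 2 * Real.sqrt 2 = 2 := Real.mul_self_sqrt (by norm_num)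
  have hs0 : 0 ≤ Real.sqrt 2 := Real.sqrt_nonneg 2
  generalize Real.sqrt 2 = s at hs hs0
  have hX : (s • A₁ - B₁ - B₂)ᴴ = s • A₁ - B₁ - B₂ := by
    simp [conjTranspose_sub, conjTranspose_smul, hA₁.eq, hB₁.eq, hB₂.eq]
  have hY : (s • A₂ - B₁ + B₂)ᴴ = s • A₂ - B₁ + B₂ := by
    simp [conjTranspose_sub, conjTranspose_add, conjTranspose_smul, hA₂.eq, hB₁.eq, hB₂.eq]
  have h1 := posSemidef_conjTranspose_mul_self (s • A₁ - B₁ - B₂)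
  have h2 := posSemidef_conjTranspose_mul_self (s • A₂ - B₁ + B₂)
  rw [hX] at h1
  rw [hY] at h2
  have h3 := (h1.add h2).smul (show (0 : ℝ) ≤ s / 4 by positivity)
  convert h3 using 1
  rw [pow_two] at hA₁2 hA₂2 hB₁2 hB₂2
  simp only [sub_mul, mul_sub, add_mul, mul_add, smul_mul_assoc, mul_smul_comm, smul_smul,
    hA₁2, hA₂2, hB₁2, hB₂2, smul_add, smul_sub, hs]
  have e : s / 4 * s = 2⁻¹ := by linarith
  simp only [e]
  module
end

section
/- Let N be a positive natural number, let ρ be a density matrix on Fin N, and let A₁, A₂, B₁, B₂ ∈ Matrix (Fin N) (Fin N) ℂ be Hermitian matrices with A₁² = 1, A₂² = 1, B₁² = 1, B₂² = 1. Then E(A₁,B₁;ρ) + E(A₁,B₂;ρ) + E(A₂,B₁;ρ) − E(A₂,B₂;ρ) ≤ 2√2, i.e. the quantum bound on the temporal Bell-like (Leggett–Garg) functional for sequential measurements is the Tsirelson value 2√2. -/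
open Matrix ComplexOrder

/-- The temporal (sequential-measurement) correlator of dichotomic observables
`A` at time `t₁` and `B` at time `t₂` on the state `ρ`:
`E(A,B;ρ) = Re((1/2) · Tr((AB + BA) ρ))`. -/
noncomputable def tempCorr {ι : Type*} [Fintype ι]
    (A B ρ : Matrix ι ι ℂ) : ℝ :=
  ((1 / 2 : ℂ) * ((A * B + B * A) * ρ).trace).re

lemma sq_trace_nonneg_aux {N : ℕ} (ρ X : Matrix (Fin N) (Fin N) ℂ) (hρ : ρ.PosSemidef)
    (hX : X.IsHermitian) : 0 ≤ ((X * X * ρ).trace).re := by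
  have h := (hρ.mul_mul_conjTranspose_same X).trace_nonneg
  rw [hX.eq, Matrix.trace_mul_comm, ← Matrix.mul_assoc] at h
  exact (Complex.le_def.mp h).1

/-- For any density matrix `ρ` and Hermitian dichotomic
observables `A₁, A₂, B₁, B₂`, the temporal Bell-like (Leggett–Garg) functional
of sequential-measurement correlators is bounded by the Tsirelson value:
`E(A₁,B₁;ρ) + E(A₁,B₂;ρ) + E(A₂,B₁;ρ) − E(A₂,B₂;ρ) ≤ 2√2`. -/
theorem temporal_chsh_tsirelson (N : ℕ) (hN : 0 < N)
    (ρ : Matrix (Fin N) (Fin N) ℂ) (hρ : ρ.PosSemidef) (hρtr : ρ.trace = 1)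
    (A₁ A₂ B₁ B₂ : Matrix (Fin N) (Fin N) ℂ)
    (hA₁ : A₁.IsHermitian) (hA₂ : A₂.IsHermitian)
    (hB₁ : B₁.IsHermitian) (hB₂ : B₂.IsHermitian)
    (hA₁2 : A₁ ^ 2 = 1) (hA₂2 : A₂ ^ 2 = 1)
    (hB₁2 : B₁ ^ 2 = 1) (hB₂2 : B₂ ^ 2 = 1) :
    tempCorr A₁ B₁ ρ + tempCorr A₁ B₂ ρ + tempCorr A₂ B₁ ρ - tempCorr A₂ B₂ ρ ≤
      2 * Real.sqrt 2 := by
  have hs : Real.sqrt 2 * Real.sqrt 2 = 2 := Real.mul_self_sqrt (by norm_num)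
  have hs0 : 0 < Real.sqrt 2 := by positivity
  generalize Real.sqrt 2 = s at hs hs0 ⊢
  have hsA : ∀ A : Matrix (Fin N) (Fin N) ℂ, A.IsHermitian → (s • A).IsHermitian := by
    intro A hA
    unfold Matrix.IsHermitian
    rw [Matrix.conjTranspose_smul, hA.eq]
    simp
  have h1 := sq_trace_nonneg_aux ρ (s • A₁ - B₁ - B₂) hρ (((hsA _ hA₁).sub hB₁).sub hB₂)
  have h2 := sq_trace_nonneg_aux ρ (s • A₂ - B₁ + B₂) hρ (((hsA _ hA₂).sub hB₁).add hB₂)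
  rw [pow_two] at hA₁2 hA₂2 hB₁2 hB₂2
  simp only [sub_mul, mul_sub, add_mul, mul_add, smul_mul_assoc, mul_smul_comm, smul_smul,
    hA₁2, hA₂2, hB₁2, hB₂2, one_mul, Matrix.trace_add, Matrix.trace_sub, Matrix.trace_smul,
    hρtr, hs, Complex.add_re, Complex.sub_re, Complex.real_smul, Complex.re_ofReal_mul,
    Complex.one_re, smul_sub] at h1 h2
  have hh : ∀ A B : Matrix (Fin N) (Fin N) ℂ, tempCorr A B ρ =
      (1 / 2) * ((A * B * ρ).trace.re + (B * A * ρ).trace.re) := by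
    intro A B
    unfold tempCorr
    rw [add_mul, Matrix.trace_add, show (1 / 2 : ℂ) = ((1 / 2 : ℝ) : ℂ) by push_cast; rfl,
      Complex.re_ofReal_mul, Complex.add_re]
  simp only [hh]
  refine le_of_mul_le_mul_left ?_ hs0
  nlinarith [h1, h2, hs]
end

section
/- Let X = !![0, 1; 1, 0] and Z = !![1, 0; 0, -1] in Matrix (Fin 2) (Fin 2) ℂ, and set A₁ = X, A₂ = Z, B₁ = (X + Z)/√2, B₂ = (X − Z)/√2. Then for every density matrix ρ on Fin 2, E(A₁,B₁;ρ) + E(A₁,B₂;ρ) + E(A₂,B₁;ρ) − E(A₂,B₂;ρ) = 2√2; that is, the temporal CHSH expression saturates the Tsirelson bound for every state of the qubit. -/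
open Matrix ComplexOrder

/-- The Pauli X matrix. -/
def pauliX : Matrix (Fin 2) (Fin 2) ℂ := !![0, 1; 1, 0]

/-- The Pauli Z matrix. -/
def pauliZ : Matrix (Fin 2) (Fin 2) ℂ := !![1, 0; 0, -1]

/-- With `A₁ = X`, `A₂ = Z`, `B₁ = (X+Z)/√2`, `B₂ = (X−Z)/√2`,
the temporal CHSH expression equals `2√2` for *every* qubit density matrix `ρ`:
the temporal correlations saturate the Tsirelson bound on every state. -/
theorem temporal_chsh_saturation
    (ρ : Matrix (Fin 2) (Fin 2) ℂ) (hρ : ρ.PosSemidef) (hρtr : ρ.trace = 1) :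
    letI A₁ := pauliX
    letI A₂ := pauliZ
    letI B₁ := (Real.sqrt 2)⁻¹ • (pauliX + pauliZ)
    letI B₂ := (Real.sqrt 2)⁻¹ • (pauliX - pauliZ)
    tempCorr A₁ B₁ ρ + tempCorr A₁ B₂ ρ + tempCorr A₂ B₁ ρ - tempCorr A₂ B₂ ρ =
      2 * Real.sqrt 2 := by
  have hs : (Real.sqrt 2)⁻¹ * 4 = 2 * Real.sqrt 2 := by
    have h2 : Real.sqrt 2 * Real.sqrt 2 = 2 := Real.mul_self_sqrt (by norm_num)
    have h0 : Real.sqrt 2 ≠ 0 := by positivity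
    field_simp
    nlinarith
  have ht : (ρ 0 0).re + (ρ 1 1).re = 1 := by
    have := congrArg Complex.re hρtr
    simpa [Matrix.trace, Fin.sum_univ_two] using this
  rw [← hs]
  generalize (Real.sqrt 2)⁻¹ = c
  simp [tempCorr, pauliX, pauliZ, Matrix.trace, Matrix.vecMul, dotProduct, Fin.sum_univ_two]
  linear_combination (4 * c) * ht
end

section
/- Let X = !![0, 1; 1, 0] and Z = !![1, 0; 0, -1] in Matrix (Fin 2) (Fin 2) ℂ, and set A₁ = X, A₂ = Z, B₁ = (X + Z)/√2, B₂ = (X − Z)/√2. For any two density matrices ρ₁ and ρ₂ on Fin 2 (the states of a single system at the first and second pair of times), writing S_τ(ρ) = E(A₁,B₁;ρ) + E(A₁,B₂;ρ) + E(A₂,B₁;ρ) − E(A₂,B₂;ρ), one has S_τ(ρ₁) + S_τ(ρ₂) = 4√2, and in particular S_τ(ρ₁) + S_τ(ρ₂) > 4, so the temporal correlations of a tripartite time sequence ABC violate the monogamous spatial Bell inequality S_AB + S_BC ≤ 4. -/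
open Matrix ComplexOrder

/-- The temporal CHSH functional with settings `A₁ = X`, `A₂ = Z`,
`B₁ = (X+Z)/√2`, `B₂ = (X−Z)/√2`. -/
noncomputable def Sτ (ρ : Matrix (Fin 2) (Fin 2) ℂ) : ℝ :=
  tempCorr pauliX ((Real.sqrt 2)⁻¹ • (pauliX + pauliZ)) ρ +
    tempCorr pauliX ((Real.sqrt 2)⁻¹ • (pauliX - pauliZ)) ρ +
    tempCorr pauliZ ((Real.sqrt 2)⁻¹ • (pauliX + pauliZ)) ρ -
    tempCorr pauliZ ((Real.sqrt 2)⁻¹ • (pauliX - pauliZ)) ρ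

theorem Stau_eq (ρ : Matrix (Fin 2) (Fin 2) ℂ) (h : ρ.trace = 1) :
    Sτ ρ = 2 * Real.sqrt 2 := by
  have hs : Real.sqrt 2 * Real.sqrt 2 = 2 := Real.mul_self_sqrt (by norm_num)
  have hpos : 0 < Real.sqrt 2 := Real.sqrt_pos.mpr (by norm_num)
  have hr : (ρ 0 0).re + (ρ 1 1).re = 1 := by
    have := congrArg Complex.re h
    simpa [Matrix.trace_fin_two] using this
  have e : Sτ ρ = 2 * Real.sqrt 2 * ((ρ 0 0).re + (ρ 1 1).re) := by
    simp [Sτ, tempCorr, pauliX, pauliZ, Matrix.trace_fin_two, Matrix.vecMul, dotProduct,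
      Fin.sum_univ_two, Complex.mul_re, Complex.add_re]
    ring
  rw [e, hr, mul_one]

/-- For any two states `ρ₁, ρ₂` of a single system at the two
pairs of consecutive times, `S_τ(ρ₁) + S_τ(ρ₂) = 4√2 > 4`: temporal
correlations of a time sequence `ABC` violate the monogamous spatial Bell
inequality `S_AB + S_BC ≤ 4`. -/
theorem temporal_monogamy_violation
    (ρ₁ ρ₂ : Matrix (Fin 2) (Fin 2) ℂ)
    (hρ₁ : ρ₁.PosSemidef) (hρ₁tr : ρ₁.trace = 1)
    (hρ₂ : ρ₂.PosSemidef) (hρ₂tr : ρ₂.trace = 1) :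
    Sτ ρ₁ + Sτ ρ₂ = 4 * Real.sqrt 2 ∧ Sτ ρ₁ + Sτ ρ₂ > 4 := by
  have hs : Real.sqrt 2 * Real.sqrt 2 = 2 := Real.mul_self_sqrt (by norm_num)
  have hpos : 0 < Real.sqrt 2 := Real.sqrt_pos.mpr (by norm_num)
  have key := Stau_eq
  have h : Sτ ρ₁ + Sτ ρ₂ = 4 * Real.sqrt 2 := by
    rw [key ρ₁ hρ₁tr, key ρ₂ hρ₂tr]; ring
  refine ⟨h, ?_⟩
  rw [h]
  nlinarith
end

section
/- Let N and n be positive natural numbers. For each i ∈ Fin n, let ρᵢ be a density matrix on Fin N and let A₁ⁱ, A₂ⁱ, B₁ⁱ, B₂ⁱ ∈ Matrix (Fin N) (Fin N) ℂ be Hermitian matrices squaring to the identity. Then Σ_{i=1}^{n} (E(A₁ⁱ,B₁ⁱ;ρᵢ) + E(A₁ⁱ,B₂ⁱ;ρᵢ) + E(A₂ⁱ,B₁ⁱ;ρᵢ) − E(A₂ⁱ,B₂ⁱ;ρᵢ)) ≤ 2√2 · n; that is, the sum of the temporal Bell-like functionals over an n-step chain of consecutive pairs of times is bounded by n times the Tsirelson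 value. -/
open Matrix ComplexOrder

theorem aux_sq_nonneg {N : ℕ} (X ρ : Matrix (Fin N) (Fin N) ℂ) (hX : X.IsHermitian)
    (hρ : ρ.PosSemidef) : 0 ≤ ((X * X * ρ).trace).re := by
  have h := (hρ.mul_mul_conjTranspose_same X).trace_nonneg
  rw [hX.eq, Matrix.trace_mul_comm, ← Matrix.mul_assoc] at h
  exact (Complex.le_def.1 h).1

theorem aux_step {N : ℕ} (ρ A₁ A₂ B₁ B₂ : Matrix (Fin N) (Fin N) ℂ)
    (hρ : ρ.PosSemidef) (hρtr : ρ.trace = 1)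
    (hA₁ : A₁.IsHermitian) (hA₂ : A₂.IsHermitian)
    (hB₁ : B₁.IsHermitian) (hB₂ : B₂.IsHermitian)
    (hA₁2 : A₁ ^ 2 = 1) (hA₂2 : A₂ ^ 2 = 1) (hB₁2 : B₁ ^ 2 = 1) (hB₂2 : B₂ ^ 2 = 1) :
    tempCorr A₁ B₁ ρ + tempCorr A₁ B₂ ρ + tempCorr A₂ B₁ ρ - tempCorr A₂ B₂ ρ
      ≤ 2 * Real.sqrt 2 := by
  have hs : Real.sqrt 2 * Real.sqrt 2 = 2 := Real.mul_self_sqrt (by norm_num)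
  have hs0 : 0 < Real.sqrt 2 := by positivity
  generalize Real.sqrt 2 = s at hs hs0 ⊢
  have hsm : ∀ {A : Matrix (Fin N) (Fin N) ℂ}, A.IsHermitian → (s • A).IsHermitian := by
    intro A hA
    simp only [Matrix.IsHermitian, Matrix.conjTranspose_smul, hA.eq, star_trivial]
  have h1 := aux_sq_nonneg (s • A₁ - (B₁ + B₂)) ρ ((hsm hA₁).sub (hB₁.add hB₂)) hρ
  have h2 := aux_sq_nonneg (s • A₂ - (B₁ - B₂)) ρ ((hsm hA₂).sub (hB₁.sub hB₂)) hρ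
  rw [pow_two] at hA₁2 hA₂2 hB₁2 hB₂2
  simp only [mul_add, mul_sub, add_mul, sub_mul, smul_mul_assoc, mul_smul_comm, smul_sub,
    smul_add, hA₁2, hA₂2, hB₁2, hB₂2, one_mul, Matrix.trace_add, Matrix.trace_sub,
    Matrix.trace_smul, hρtr, Complex.add_re, Complex.sub_re, Complex.smul_re, smul_eq_mul,
    Complex.one_re] at h1 h2
  have hh : ∀ z : ℂ, ((1 / 2 : ℂ) * z).re = z.re / 2 := by
    intro z
    simp [Complex.mul_re]
    ring
  simp only [tempCorr, hh, add_mul, Matrix.trace_add, Complex.add_re]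
  refine le_of_mul_le_mul_left ?_ hs0
  nlinarith

/-- For an `n`-step chain of consecutive pairs of times, with
a density matrix `ρ i` and Hermitian dichotomic observables `A₁ i, A₂ i, B₁ i,
B₂ i` at each step `i`, the sum of the temporal Bell-like functionals is
bounded by `n` times the Tsirelson value: `∑ᵢ S_LGI(i) ≤ 2√2 · n`. -/
theorem temporal_chain_tsirelson_bound (N n : ℕ) (hN : 0 < N) (hn : 0 < n)
    (ρ : Fin n → Matrix (Fin N) (Fin N) ℂ)
    (hρ : ∀ i, (ρ i).PosSemidef) (hρtr : ∀ i, (ρ i).trace = 1)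
    (A₁ A₂ B₁ B₂ : Fin n → Matrix (Fin N) (Fin N) ℂ)
    (hA₁ : ∀ i, (A₁ i).IsHermitian) (hA₂ : ∀ i, (A₂ i).IsHermitian)
    (hB₁ : ∀ i, (B₁ i).IsHermitian) (hB₂ : ∀ i, (B₂ i).IsHermitian)
    (hA₁2 : ∀ i, A₁ i ^ 2 = 1) (hA₂2 : ∀ i, A₂ i ^ 2 = 1)
    (hB₁2 : ∀ i, B₁ i ^ 2 = 1) (hB₂2 : ∀ i, B₂ i ^ 2 = 1) :
    ∑ i : Fin n, (tempCorr (A₁ i) (B₁ i) (ρ i) + tempCorr (A₁ i) (B₂ i) (ρ i) +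
        tempCorr (A₂ i) (B₁ i) (ρ i) - tempCorr (A₂ i) (B₂ i) (ρ i)) ≤
      2 * Real.sqrt 2 * n := by
  calc _ ≤ ∑ _i : Fin n, 2 * Real.sqrt 2 := Finset.sum_le_sum fun i _ =>
        aux_step _ _ _ _ _ (hρ i) (hρtr i) (hA₁ i) (hA₂ i) (hB₁ i) (hB₂ i)
          (hA₁2 i) (hA₂2 i) (hB₁2 i) (hB₂2 i)
    _ = 2 * Real.sqrt 2 * n := by
      simp [mul_comm]
end

section
/- Let n be a positive natural number. There exist Hermitian matrices A₁, A₂, B₁, B₂ ∈ Matrix (Fin 2) (Fin 2) ℂ squaring to the identity (namely A₁ = X, A₂ = Z, B₁ = (X+Z)/√2, B₂ = (X−Z)/√2) such that for every choice of density matrices ρ₁, …, ρₙ on Fin 2, Σ_{i=1}^{n} (E(A₁,B₁;ρᵢ) + E(A₁,B₂;ρᵢ) + E(A₂,B₁;ρᵢ) − E(A₂,B₂;ρᵢ)) = 2√2 · n; hence the multi-time quantum bound Σᵢ S_LGI ≤ 2√2·n is saturated, violating the spatial monogamy relations Σᵢ B(A₀,Aᵢ) ≤ 2n for n ≥ 2.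 -/
open Matrix ComplexOrder

/-- There exist Hermitian dichotomic observables
`A₁, A₂, B₁, B₂` on a qubit — namely `A₁ = X`, `A₂ = Z`, `B₁ = (X+Z)/√2`,
`B₂ = (X−Z)/√2` — such that for every choice of density matrices
`ρ₁, …, ρₙ`, the sum of the `n` temporal Bell-like functionals equals
`2√2 · n`, saturating the multi-time quantum bound `∑ᵢ S_LGI ≤ 2√2·n` and
thereby violating the spatial monogamy relation `∑ᵢ B(A₀,Aᵢ) ≤ 2n` for
`n ≥ 2`. -/
theorem multitime_tsirelson_saturation (n : ℕ) (hn : 0 < n) :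
    ∃ A₁ A₂ B₁ B₂ : Matrix (Fin 2) (Fin 2) ℂ,
      A₁ = pauliX ∧ A₂ = pauliZ ∧
      B₁ = (Real.sqrt 2)⁻¹ • (pauliX + pauliZ) ∧
      B₂ = (Real.sqrt 2)⁻¹ • (pauliX - pauliZ) ∧
      A₁.IsHermitian ∧ A₂.IsHermitian ∧ B₁.IsHermitian ∧ B₂.IsHermitian ∧
      A₁ ^ 2 = 1 ∧ A₂ ^ 2 = 1 ∧ B₁ ^ 2 = 1 ∧ B₂ ^ 2 = 1 ∧
      ∀ ρ : Fin n → Matrix (Fin 2) (Fin 2) ℂ,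
        (∀ i, (ρ i).PosSemidef) → (∀ i, (ρ i).trace = 1) →
        ∑ i : Fin n, (tempCorr A₁ B₁ (ρ i) + tempCorr A₁ B₂ (ρ i) +
            tempCorr A₂ B₁ (ρ i) - tempCorr A₂ B₂ (ρ i)) =
          2 * Real.sqrt 2 * n := by
  have h2 : (Real.sqrt 2) * (Real.sqrt 2) = 2 := Real.mul_self_sqrt (by norm_num)
  have h0 : Real.sqrt 2 ≠ 0 := by positivity
  have hs : (Real.sqrt 2)⁻¹ * (Real.sqrt 2)⁻¹ = 1 / 2 := by
    rw [← mul_inv, h2]; norm_num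
  have hs' : ((Real.sqrt 2)⁻¹ : ℝ) = Real.sqrt 2 / 2 := by
    field_simp; nlinarith
  generalize (Real.sqrt 2)⁻¹ = c at hs hs'
  have hc : (c : ℂ) * (c : ℂ) = 1 / 2 := by
    rw [← Complex.ofReal_mul, hs]; norm_num
  refine ⟨_, _, _, _, rfl, rfl, rfl, rfl, ?_, ?_, ?_, ?_, ?_, ?_, ?_, ?_, ?_⟩
  · ext i j; fin_cases i <;> fin_cases j <;> simp [pauliX]
  · ext i j; fin_cases i <;> fin_cases j <;> simp [pauliZ]
  · ext i j; fin_cases i <;> fin_cases j <;> simp [pauliX, pauliZ]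
  · ext i j; fin_cases i <;> fin_cases j <;> simp [pauliX, pauliZ]
  · ext i j; fin_cases i <;> fin_cases j <;> simp [pauliX, pow_two]
  · ext i j; fin_cases i <;> fin_cases j <;> simp [pauliZ, pow_two]
  · ext i j; fin_cases i <;> fin_cases j <;>
      simp [pauliX, pauliZ, pow_two, Matrix.mul_apply, hc] <;> norm_num
  · ext i j; fin_cases i <;> fin_cases j <;>
      simp [pauliX, pauliZ, pow_two, Matrix.mul_apply, hc] <;> norm_num
  · intro ρ _ ht
    have key : ∀ i, tempCorr pauliX (c • (pauliX + pauliZ)) (ρ i) +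
        tempCorr pauliX (c • (pauliX - pauliZ)) (ρ i) +
        tempCorr pauliZ (c • (pauliX + pauliZ)) (ρ i) -
        tempCorr pauliZ (c • (pauliX - pauliZ)) (ρ i) = 2 * Real.sqrt 2 := by
      intro i
      have h := congrArg Complex.re (ht i)
      simp [Matrix.trace, Fin.sum_univ_two] at h
      simp [tempCorr, pauliX, pauliZ, Matrix.trace, Fin.sum_univ_two, Matrix.vecMul, dotProduct]
      linear_combination (4 * c) * h + 4 * hs'
    rw [Finset.sum_congr rfl (fun i _ => key i)]
    simp; ring
end

section
/- Let n ≥ 2 and m ≥ 1 be natural numbers, let φ⁺ : Fin n × Fin n → ℂ be the maximally entangled state vector φ⁺(i,j) = (1/√n) if i = j and 0 otherwise, with rank-one projector Φ⁺((i,j),(k,l)) = φ⁺(i,j) · conj(φ⁺(k,l)). If ρ is a density matrix on (Fin n × Fin n) × Fin m whose partial trace over the last factor equals Φ⁺, then ρ factorizes: ρ(((a,b),c),((a',b'),c')) = Φ⁺((a,b),(a',b')) · σ(c,c') for all indices, where σ(c,c') = Σ_{(a,b)} ρ(((a,b),c),((a,b),c')) is the partial trace of ρ over the first two factors; i.e.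 any extension of a maximally entangled pair AB to a third party C is of the product form Φ⁺ ⊗ ρ_C. -/
open Matrix ComplexOrder

/-- The maximally entangled state vector `φ⁺(i,j) = 1/√n` if `i = j`, else `0`. -/
noncomputable def phiPlus (n : ℕ) : Fin n × Fin n → ℂ :=
  fun p => if p.1 = p.2 then ((Real.sqrt n : ℂ))⁻¹ else 0

/-- The rank-one projector `Φ⁺ = |φ⁺⟩⟨φ⁺|` onto the maximally entangled state. -/
noncomputable def PhiPlus (n : ℕ) : Matrix (Fin n × Fin n) (Fin n × Fin n) ℂ :=
  Matrix.of fun p q => phiPlus n p * star (phiPlus n q)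

theorem aux_kill {P C K : Type*} [Fintype P] [Fintype C] [Fintype K] (φ : P → ℂ)
    (B : K → P → C → ℂ)
    (h : ∀ p q, ∑ c, ∑ k, star (B k p c) * B k q c = φ p * star (φ q))
    (x : P → ℂ) (hx : ∑ q, star (φ q) * x q = 0) (k : K) (c : C) :
    ∑ q, x q * B k q c = 0 := by
  have key : ∑ c, ∑ k, star (∑ q, x q * B k q c) * (∑ q, x q * B k q c) = 0 := by
    calc _ = ∑ c, ∑ k, ∑ p, ∑ q, (star (x p) * x q) * (star (B k p c) * B k q c) := by
          refine Finset.sum_congr rfl fun c _ => Finset.sum_congr rfl fun k _ => ?_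
          rw [star_sum, Finset.sum_mul_sum]
          refine Finset.sum_congr rfl fun p _ => Finset.sum_congr rfl fun q _ => ?_
          rw [star_mul]; ring
      _ = ∑ p, ∑ q, (star (x p) * x q) * ∑ c, ∑ k, star (B k p c) * B k q c := by
          simp_rw [Finset.mul_sum]
          rw [← Fintype.sum_prod_type', ← Fintype.sum_prod_type']
          simp_rw [← Fintype.sum_prod_type']
          let e : ((C × K) × P) × P ≃ P × P × C × K :=
            ⟨fun a => (a.1.2, a.2, a.1.1), fun a => ((a.2.2, a.1), a.2.1),
              fun _ => rfl, fun _ => rfl⟩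
          refine Fintype.sum_equiv e _ _ ?_
          intro _
          rfl
      _ = ∑ p, (star (x p) * φ p) * ∑ q, star (φ q) * x q := by
          simp_rw [h, Finset.mul_sum]
          refine Finset.sum_congr rfl fun p _ => Finset.sum_congr rfl fun q _ => ?_
          ring
      _ = 0 := by simp only [hx, mul_zero, Finset.sum_const_zero]
  have h1 := (Finset.sum_eq_zero_iff_of_nonneg
    (fun c _ => Finset.sum_nonneg fun k _ => star_mul_self_nonneg _)).1 key c (Finset.mem_univ _)
  have h2 := (Finset.sum_eq_zero_iff_of_nonneg
    (fun k _ => star_mul_self_nonneg _)).1 h1 k (Finset.mem_univ _)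
  exact (CStarRing.star_mul_self_eq_zero_iff _).1 h2

/-- **monogamy: extensions of a maximally entangled pair are
product states.** For `n ≥ 2`, `m ≥ 1`, any density matrix `ρ` on
`(Fin n × Fin n) × Fin m` whose partial trace over the last factor is the
maximally entangled projector `Φ⁺` factorizes as
`ρ((p,c),(q,c')) = Φ⁺(p,q) · σ(c,c')`, where `σ` is the partial trace of `ρ`
over the first two factors. -/
theorem maximally_entangled_extension_is_product (n m : ℕ) (hn : 2 ≤ n) (hm : 1 ≤ m)
    (ρ : Matrix ((Fin n × Fin n) × Fin m) ((Fin n × Fin n) × Fin m) ℂ)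
    (hρ : ρ.PosSemidef) (hρtr : ρ.trace = 1)
    (hmarg : ∀ p q : Fin n × Fin n, (∑ c, ρ (p, c) (q, c)) = PhiPlus n p q) :
    ∀ (p q : Fin n × Fin n) (c c' : Fin m),
      ρ (p, c) (q, c') = PhiPlus n p q * (∑ r : Fin n × Fin n, ρ (r, c) (r, c')) := by
  obtain ⟨B, hB⟩ : ∃ B : Matrix ((Fin n × Fin n) × Fin m) ((Fin n × Fin n) × Fin m) ℂ,
      ρ = Bᴴ * B := by
    open scoped MatrixOrder in
    exact CStarAlgebra.nonneg_iff_eq_star_mul_self.mp hρ.nonneg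
  have hent : ∀ p q c c', ρ (p, c) (q, c') = ∑ k, star (B k (p, c)) * B k (q, c') := by
    intro p q c c'
    rw [hB]; simp [Matrix.mul_apply]
  have hnorm : ∑ r, PhiPlus n r r = 1 := by
    rw [← hρtr, Matrix.trace]
    refine Eq.trans ?_ (Fintype.sum_prod_type _).symm
    exact Finset.sum_congr rfl fun r _ => (hmarg r r).symm
  have hkill := aux_kill (phiPlus n) (fun k p c => B k (p, c)) (by
    intro p q
    simp_rw [← hent]
    exact hmarg p q)
  have hB2 : ∀ k q c, B k (q, c) = star (phiPlus n q) * ∑ r, phiPlus n r * B k (r, c) := by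
    intro k q c
    have := hkill (fun r => (if r = q then 1 else 0) - star (phiPlus n q) * phiPlus n r) (by
      simp only [mul_sub, Finset.sum_sub_distrib, mul_ite, mul_one, mul_zero,
        Finset.sum_ite_eq', Finset.mem_univ, if_true]
      have h3 : ∑ r, star (phiPlus n r) * (star (phiPlus n q) * phiPlus n r)
          = star (phiPlus n q) * ∑ r, PhiPlus n r r := by
        rw [Finset.mul_sum]
        refine Finset.sum_congr rfl fun r _ => ?_
        simp only [PhiPlus, Matrix.of_apply]; ring
      rw [h3, hnorm]; ring) k c
    simp only [sub_mul, Finset.sum_sub_distrib, ite_mul, one_mul, zero_mul,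
        Finset.sum_ite_eq', Finset.mem_univ, if_true] at this
    rw [sub_eq_zero] at this
    rw [this, Finset.mul_sum]
    exact Finset.sum_congr rfl fun r _ => by ring
  have hfac : ∀ p q c c', ρ (p, c) (q, c') = PhiPlus n p q *
      ∑ k, star (∑ r, phiPlus n r * B k (r, c)) * (∑ r, phiPlus n r * B k (r, c')) := by
    intro p q c c'
    rw [hent, Finset.mul_sum]
    refine Finset.sum_congr rfl fun k _ => ?_
    rw [hB2 k p c, hB2 k q c', star_mul, star_star]
    simp only [PhiPlus, Matrix.of_apply]; ring
  intro p q c c'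
  rw [Finset.sum_congr rfl fun r _ => hfac r r c c', ← Finset.sum_mul, hnorm, one_mul]
  exact hfac p q c c'
end

section
/- Let P, Q ∈ Matrix (Fin 2) (Fin 2) ℂ be orthogonal projections (P² = P, Pᴴ = P, Q² = Q, Qᴴ = Q) and suppose Q is symmetric (Qᵀ = Q). Let φ⁺ : Fin 2 × Fin 2 → ℂ be the maximally entangled two-qubit state vector φ⁺(i,j) = (1/√2) if i = j and 0 otherwise, with rank-one projector Φ⁺((i,j),(k,l)) = φ⁺(i,j) · conj(φ⁺(k,l)). Then the joint probability of obtaining outcomes P then Q in consecutive projective measurements on the maximally mixed qubit state equals the probability of the joint outcome P ⊗ Q on the maximally entangled pair: Tr(Q * P * ((1/2) • 1) * P) = Tr((P ⊗ₖ Q) * Φ⁺). -/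
open Matrix Kronecker

/-- For orthogonal projections `P, Q` on a qubit with `Q`
symmetric, the joint probability of the consecutive outcomes `P` then `Q` on
the maximally mixed qubit state equals the Born-rule probability of the joint
outcome `P ⊗ Q` on the maximally entangled two-qubit state:
`Tr(Q P ((1/2) • 1) P) = Tr((P ⊗ₖ Q) Φ⁺)`. -/
theorem sequential_measurement_matches_entangled_pair
    (P Q : Matrix (Fin 2) (Fin 2) ℂ)
    (hP2 : P * P = P) (hPH : P.IsHermitian)
    (hQ2 : Q * Q = Q) (hQH : Q.IsHermitian) (hQsym : Qᵀ = Q) :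
    (Q * P * ((1 / 2 : ℂ) • (1 : Matrix (Fin 2) (Fin 2) ℂ)) * P).trace =
      ((P ⊗ₖ Q) * PhiPlus 2).trace := by
  have h : (Q * P * ((1 / 2 : ℂ) • (1 : Matrix (Fin 2) (Fin 2) ℂ)) * P) = (1/2 : ℂ) • (Q * P) := by
    rw [Matrix.mul_smul, Matrix.mul_one, Matrix.smul_mul, Matrix.mul_assoc, hP2]
  have hs : ((Real.sqrt 2 : ℂ))⁻¹ * ((Real.sqrt 2 : ℂ))⁻¹ = 1 / 2 := by
    rw [← mul_inv, ← Complex.ofReal_mul, Real.mul_self_sqrt (by norm_num)]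
    norm_num
  have hq : Q 1 0 = Q 0 1 := congrFun (congrFun hQsym 0) 1
  rw [h]
  simp [Matrix.trace, Matrix.mul_apply, Fintype.sum_prod_type, Fin.sum_univ_two, PhiPlus, phiPlus,
    Matrix.kroneckerMap_apply, hq]
  linear_combination (-(P 0 0 * Q 0 0 + P 0 1 * Q 0 1 + P 1 0 * Q 0 1 + P 1 1 * Q 1 1)) * hs
end
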